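/- Let L ⊆ V^P be an isotropic subspace free of zero, trivial, and Bell factors. Then there exists a local symplectic automorphism of V^P (an element of Sp(V)^P acting factor-wise) after which, for each contiguity class S ∈ 𝒮, either L_S = ⟨z_p + z_q : p ≠ q ∈ S⟩ or L_S = ⟨z_p + z_q : p ≠ q ∈ S⟩ + ⟨Σ_{s∈S} x_s⟩. -/

import Mathlib

/- Common framework: binary stabilizer codes, local unitary/SO(3) automorphism groups. -/

noncomputable section
open scoped Matrix Real ComplexConjugate
open scoped Classical

namespace Stab

/-- The one-qubit phase space `V = 𝔽₂ ⊕ 𝔽₂`, with first coordinate the `z`-component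
and second coordinate the `x`-component. -/
abbrev V : Type := ZMod 2 × ZMod 2

/-- The symplectic form on `V`. -/
def omegaV (u v : V) : ZMod 2 := u.1 * v.2 + u.2 * v.1

/-- The phase space `V^P` over a set of qubits `P`. -/
abbrev QV (P : Type) := P → V

variable {P : Type} [Fintype P] [DecidableEq P]

/-- The direct-sum symplectic form on `V^P`. -/
def omega (u v : QV P) : ZMod 2 := ∑ p, omegaV (u p) (v p)

/-- A subspace `L ⊆ V^P` is isotropic if `ω` vanishes identically on `L × L`. -/
def Isotropic (L : Submodule (ZMod 2) (QV P)) : Prop := ∀ u ∈ L, ∀ v ∈ L, omega u v = 0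

/-- Support of a vector of `V^P`. -/
def supp (v : QV P) : Set P := {p | v p ≠ 0}

/-- The basis vector `z_p`. -/
def zvec (p : P) : QV P := Pi.single p ((1 : ZMod 2), (0 : ZMod 2))

/-- The basis vector `x_p`. -/
def xvec (p : P) : QV P := Pi.single p ((0 : ZMod 2), (1 : ZMod 2))

/-- Restriction (coordinate projection) of a vector to a subset `S ⊆ P`. -/
def restrTo (S : Set P) (v : QV P) : QV P := fun p => if p ∈ S then v p else 0

/-- The coordinate subspace `V^S ⊆ V^P`. -/
def coordSub (S : Set P) : Submodule (ZMod 2) (QV P) where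
  carrier := {v | ∀ p ∉ S, v p = 0}
  add_mem' := by intro a b ha hb p hp; simp [Pi.add_apply, ha p hp, hb p hp]
  zero_mem' := by intro p _; rfl
  smul_mem' := by intro c a ha p hp; simp [Pi.smul_apply, ha p hp]

/-- `L_S := L ∩ V^S`. -/
def LS (L : Submodule (ZMod 2) (QV P)) (S : Set P) : Submodule (ZMod 2) (QV P) :=
  L ⊓ coordSub S

/-- `L` splits as a direct factor on `S`, i.e. `L = L_S × L_{P∖S}`. -/
def SplitsOn (L : Submodule (ZMod 2) (QV P)) (S : Set P) : Prop :=
  ∀ v ∈ L, restrTo S v ∈ L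

/-- `L` splits off a zero factor: on some nonempty `S ⊆ P` all vectors of `L` vanish. -/
def HasZeroFactor (L : Submodule (ZMod 2) (QV P)) : Prop :=
  ∃ S : Set P, S.Nonempty ∧ ∀ v ∈ L, ∀ p ∈ S, v p = 0

/-- The qubit `p` is trivial: `L` splits off a one-dimensional factor on `{p}`. -/
def TrivialQubit (L : Submodule (ZMod 2) (QV P)) (p : P) : Prop :=
  SplitsOn L {p} ∧ ∃ v ∈ L, v ≠ 0 ∧ supp v ⊆ {p}

/-- `L` splits off a trivial factor. -/
def HasTrivialFactor (L : Submodule (ZMod 2) (QV P)) : Prop :=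
  ∃ p : P, TrivialQubit L p

/-- `L` splits off a Bell Lagrangian: an indecomposable Lagrangian direct factor on a
two-element set of qubits (all of whose nonzero vectors have full support `{p, q}`). -/
def HasBellFactor (L : Submodule (ZMod 2) (QV P)) : Prop :=
  ∃ p q : P, p ≠ q ∧ SplitsOn L {p, q} ∧
    ∃ v ∈ L, ∃ w ∈ L, v ≠ w ∧ supp v = {p, q} ∧ supp w = {p, q} ∧ supp (v + w) = {p, q}

/-- The factor `L_S` (for `S` in a partition) is indecomposable. -/
def IndecompWithin (L : Submodule (ZMod 2) (QV P)) (S : Set P) : Prop :=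
  ∀ T ⊆ S, SplitsOn L T → T = ∅ ∨ T = S

/-! ### The Hilbert space, Pauli operators and stabilizer codes -/

/-- The state space `ℋ^{⊗P} = (ℂ²)^{⊗P}`, realised concretely as functions on
computational basis labels. -/
abbrev HP (P : Type) := (P → Fin 2) → ℂ

/-- Operators on `ℋ^{⊗P}` as matrices. -/
abbrev MatP (P : Type) := Matrix (P → Fin 2) (P → Fin 2) ℂ

/-- The tensor (local) operator `⊗_{p} g_p` on `ℋ^{⊗P}`. -/
def locOp (g : P → Matrix (Fin 2) (Fin 2) ℂ) : MatP P :=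
  Matrix.of fun u w => ∏ p, g p (u p) (w p)

def sigmaX : Matrix (Fin 2) (Fin 2) ℂ := !![0, 1; 1, 0]
def sigmaY : Matrix (Fin 2) (Fin 2) ℂ := !![0, -Complex.I; Complex.I, 0]
def sigmaZ : Matrix (Fin 2) (Fin 2) ℂ := !![1, 0; 0, -1]

/-- The one-qubit Pauli operator `Z^a X^b` attached to `(a, b) ∈ V`. -/
def pauliMat (v : V) : Matrix (Fin 2) (Fin 2) ℂ := sigmaZ ^ (v.1 : ZMod 2).val * sigmaX ^ (v.2 : ZMod 2).val

/-- The Pauli (Weyl) operator attached to `v ∈ V^P`. -/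
def Wop (v : QV P) : MatP P := locOp fun p => pauliMat (v p)

/-- A group-homomorphic section `σ` over `L` of the projection from the Pauli group
`Ṽ^P` onto `V^P`: each value `σ(v)` is a unitary scalar multiple of the Pauli operator
`W(v)`, and `σ` is multiplicative on `L`. -/
structure PauliSection (L : Submodule (ZMod 2) (QV P)) where
  toFun : QV P → MatP P
  scalar : ∀ v : QV P, ∃ c : ℂ, toFun v = c • Wop v
  unitary : ∀ v : QV P, toFun v ∈ Matrix.unitaryGroup (P → Fin 2) ℂ
  mul_of_mem : ∀ u ∈ L, ∀ v ∈ L, toFun (u + v) = toFun u * toFun v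
  map_zero : toFun 0 = 1

/-- The stabilizer code `C(L, σ)`: the common fixed-point space of the stabilizer
group `σ(L)`. -/
def code (L : Submodule (ZMod 2) (QV P)) (σ : PauliSection L) : Submodule ℂ (HP P) where
  carrier := {ψ | ∀ v ∈ L, σ.toFun v *ᵥ ψ = ψ}
  add_mem' := by intro a b ha hb v hv; rw [Matrix.mulVec_add, ha v hv, hb v hv]
  zero_mem' := by intro v hv; simp
  smul_mem' := by intro c a ha v hv; rw [Matrix.mulVec_smul, ha v hv]

/-- The standard section: `σ(v) = W(v)` on `L`. -/
def StandardOn (L : Submodule (ZMod 2) (QV P)) (σ : PauliSection L) : Prop :=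
  ∀ v ∈ L, σ.toFun v = Wop v

/-! ### `SO(3)`, rotations, and the automorphism group of a code -/

/-- `3×3` real matrices. -/
abbrev Rot : Type := Matrix (Fin 3) (Fin 3) ℝ

/-- `SO(3)` as a set of `3×3` real matrices. -/
def SO3 : Set Rot := {A | A * Aᵀ = 1 ∧ A.det = 1}

/-- The ordered Pauli basis (x, y, z) of traceless Hermitian `2×2` matrices. -/
def pauliBasis : Fin 3 → Matrix (Fin 2) (Fin 2) ℂ := ![sigmaX, sigmaY, sigmaZ]

/-- The image of a unitary `u ∈ U(2)` in `SO(3)` under the adjoint action on traceless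
Hermitian operators (the identification `U(2)/S¹ = SO(3)`):
`u σ_j u† = Σ_i (adjRot u)_{ij} σ_i`. -/
def adjRot (u : Matrix (Fin 2) (Fin 2) ℂ) : Rot :=
  Matrix.of fun i j =>
    (1 / 2 : ℝ) * ((pauliBasis i * u * pauliBasis j * u.conjTranspose).trace).re

/-- Rotation about the `x`-axis by angle `θ`. -/
def rotX (θ : ℝ) : Rot := !![1, 0, 0; 0, Real.cos θ, -Real.sin θ; 0, Real.sin θ, Real.cos θ]

/-- Rotation about the `y`-axis by angle `θ`. -/
def rotY (θ : ℝ) : Rot := !![Real.cos θ, 0, Real.sin θ; 0, 1, 0; -Real.sin θ, 0, Real.cos θ]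

/-- Rotation about the `z`-axis by angle `θ`. -/
def rotZ (θ : ℝ) : Rot := !![Real.cos θ, -Real.sin θ, 0; Real.sin θ, Real.cos θ, 0; 0, 0, 1]

/-- The circle group `C_x ⊆ SO(3)` of rotations about the `x`-axis. -/
def Cx : Set Rot := Set.range rotX

/-- The circle group `C_y ⊆ SO(3)` of rotations about the `y`-axis. -/
def Cy : Set Rot := Set.range rotY

/-- The circle group `C_z ⊆ SO(3)` of rotations about the `z`-axis. -/
def Cz : Set Rot := Set.range rotZ

/-- The octahedral group: the subgroup of `SO(3)` generated by the rotations by a right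
angle about the three coordinate axes. -/
def octahedral : Set Rot :=
  (Submonoid.closure {rotX (π / 2), rotY (π / 2), rotZ (π / 2)} : Submonoid Rot)

/-- The infinite dihedral group `D_x ⊆ SO(3)`. -/
def Dx : Set Rot := (Submonoid.closure (Cx ∪ {rotZ π}) : Submonoid Rot)

/-- The infinite dihedral group `D_y ⊆ SO(3)`. -/
def Dy : Set Rot := (Submonoid.closure (Cy ∪ {rotZ π}) : Submonoid Rot)

/-- The infinite dihedral group `D_z ⊆ SO(3)`. -/
def Dz : Set Rot := (Submonoid.closure (Cz ∪ {rotX π}) : Submonoid Rot)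

/-- The automorphism group `A(L, σ) ⊆ SO(3)^P` of the stabilizer code `C(L, σ)`:
all families of rotations admitting a local unitary lift mapping the code into itself. -/
def autSet (L : Submodule (ZMod 2) (QV P)) (σ : PauliSection L) : Set (P → Rot) :=
  {g | ∃ u : P → Matrix (Fin 2) (Fin 2) ℂ,
        (∀ p, u p ∈ Matrix.unitaryGroup (Fin 2) ℂ) ∧
        (∀ p, adjRot (u p) = g p) ∧
        ∀ ψ ∈ code L σ, locOp u *ᵥ ψ ∈ code L σ}

/-- The automorphism group `A(L, σ)_p` at the qubit `p`. -/
def autSetAt (L : Submodule (ZMod 2) (QV P)) (σ : PauliSection L) (p : P) : Set Rot :=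
  (fun g => g p) '' autSet L σ

/-- The normal subgroup `Z(L, σ)` of automorphisms acting by a scalar on the code. -/
def zSet (L : Submodule (ZMod 2) (QV P)) (σ : PauliSection L) : Set (P → Rot) :=
  {g | ∃ u : P → Matrix (Fin 2) (Fin 2) ℂ,
        (∀ p, u p ∈ Matrix.unitaryGroup (Fin 2) ℂ) ∧
        (∀ p, adjRot (u p) = g p) ∧
        ∃ c : ℂ, ∀ ψ ∈ code L σ, locOp u *ᵥ ψ = c • ψ}

/-! ### Restriction to subsets of qubits -/

/-- Restriction of a phase-space vector to the qubits of `S`. -/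
def resQV (S : Set P) (v : QV P) : QV ↥S := fun s => v s

/-- Restriction as a linear map. -/
def resLin (S : Set P) : QV P →ₗ[ZMod 2] QV ↥S where
  toFun := resQV S
  map_add' := by intros; rfl
  map_smul' := by intros; rfl

/-- `L_S`, regarded as a subspace of `V^S`. -/
def LSsub (L : Submodule (ZMod 2) (QV P)) (S : Set P) : Submodule (ZMod 2) (QV ↥S) :=
  Submodule.map (resLin S) (LS L S)

/-- The extension `M ⊗ 1` to `ℋ^{⊗P}` of an operator `M` on `ℋ^{⊗S}`. -/
def extendOp (S : Set P) (M : Matrix (↥S → Fin 2) (↥S → Fin 2) ℂ) : MatP P :=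
  Matrix.of fun u w =>
    if ∀ p ∉ S, u p = w p then M (fun s => u s) (fun s => w s) else 0

/-- `σ'` is the restriction `σ|_{L_S}` of the section `σ` to `L_S`. -/
def RestrictedSection (L : Submodule (ZMod 2) (QV P)) (σ : PauliSection L) (S : Set P)
    (σ' : PauliSection (LSsub L S)) : Prop :=
  ∀ v ∈ LS L S, extendOp S (σ'.toFun (resQV S v)) = σ.toFun v

/-! ### Contiguity, protected and gauge qubits, and normal forms -/

/-- Two qubits are contiguous if they are equal or `L` contains a vector supported
exactly on the pair. -/
def Contig (L : Submodule (ZMod 2) (QV P)) (p q : P) : Prop :=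
  p = q ∨ ∃ v ∈ L, supp v = ({p, q} : Set P)

/-- The contiguity class of a qubit. -/
def contigClass (L : Submodule (ZMod 2) (QV P)) (p : P) : Set P := {q | Contig L p q}

/-- The qubit `p` is protected: the projection `L → V^{{p}}` is surjective. -/
def IsProtected (L : Submodule (ZMod 2) (QV P)) (p : P) : Prop :=
  ∀ w : V, ∃ v ∈ L, v p = w

/-- The qubit `p` is of gauge type: the projection `L → V^{{p}}` has a line as image. -/
def IsGauge (L : Submodule (ZMod 2) (QV P)) (p : P) : Prop :=
  ¬ IsProtected L p ∧ ∃ v ∈ L, v p ≠ 0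

/-- The subspace `⟨z_a + z_b : a ≠ b ∈ S⟩`. -/
def zspan (S : Set P) : Submodule (ZMod 2) (QV P) :=
  Submodule.span (ZMod 2) {w | ∃ a ∈ S, ∃ b ∈ S, a ≠ b ∧ w = zvec a + zvec b}

/-- The vector `Σ_{s ∈ S} x_s`. -/
def xsumOn (S : Set P) : QV P := S.indicator fun _ => ((0 : ZMod 2), (1 : ZMod 2))

/-- Normal form of `L` (conclusion of the normalisation lemma): every contiguity class `S`
carries either `⟨z_a + z_b⟩` or `⟨z_a + z_b⟩ + ⟨Σ_{s∈S} x_s⟩`. -/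
def NormalForm (L : Submodule (ZMod 2) (QV P)) : Prop :=
  ∀ p : P,
    LS L (contigClass L p) = zspan (contigClass L p) ∨
    LS L (contigClass L p) =
      zspan (contigClass L p) ⊔ Submodule.span (ZMod 2) {xsumOn (contigClass L p)}

/-- The pair `(L, σ)` is normalised. -/
def Normalised (L : Submodule (ZMod 2) (QV P)) (σ : PauliSection L) : Prop :=
  NormalForm L ∧
  (∀ p : P, IsGauge L p → contigClass L p = {p} → ∀ v ∈ L, (v p).2 = 0) ∧
  (∀ p : P, IsProtected L p → contigClass L p = {p} →
    connectedComponentIn (autSetAt L σ p) 1 ⊆ Cz) ∧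
  (∀ p : P, IsProtected L p → contigClass L p ≠ {p} →
    LS L (contigClass L p) = zspan (contigClass L p) →
    ∃ v ∈ L, ∀ s ∈ contigClass L p, v s = ((0 : ZMod 2), (1 : ZMod 2))) ∧
  (∀ p q : P, p ≠ q → Contig L p q →
    σ.toFun (zvec p + zvec q) = Wop (zvec p + zvec q))

/-- A local symplectic family of automorphisms of `V`. -/
def IsLocalSymp (f : P → (V ≃ₗ[ZMod 2] V)) : Prop :=
  ∀ (p : P) (u v : V), omegaV (f p u) (f p v) = omegaV u v

/-- The image of `L` under a local (symplectic) transformation. -/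
def mapL (L : Submodule (ZMod 2) (QV P)) (f : P → (V ≃ₗ[ZMod 2] V)) :
    Submodule (ZMod 2) (QV P) :=
  Submodule.map (LinearEquiv.piCongrRight f : QV P ≃ₗ[ZMod 2] QV P).toLinearMap L

/-! ### Abstract group structures carried by subsets of a monoid -/

/-- The set `s` carries the structure of a solvable group. -/
structure SolvableGroupStructure (M : Type) [Monoid M] (s : Set M) where
  G : Type
  [grp : Group G]
  solv : IsSolvable G
  f : G → M
  inj : Function.Injective f
  map_mul : ∀ a b : G, f (a * b) = f a * f b
  range_eq : Set.range f = s

/-- The quotient of the group (carried by) `A` by the normal subgroup (carried by) `Z`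
is a compact solvable topological (Lie) group. -/
structure CompactSolvableQuotientStructure (M : Type) [Monoid M] [TopologicalSpace M]
    (A Z : Set M) where
  G : Type
  [grp : Group G]
  [top : TopologicalSpace G]
  [tgrp : IsTopologicalGroup G]
  cpt : CompactSpace G
  solv : IsSolvable G
  φ : M → G
  cont : ContinuousOn φ A
  map_mul' : ∀ a ∈ A, ∀ b ∈ A, φ (a * b) = φ a * φ b
  surj : ∀ y : G, ∃ a ∈ A, φ a = y
  ker : ∀ a ∈ A, (φ a = 1 ↔ a ∈ Z)

/-! ### Logical qubits and transversally realisable gates -/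

/-- The standard hermitian inner product on a finite-dimensional function space. -/
def innerF {ι : Type} [Fintype ι] (ψ φ : ι → ℂ) : ℂ := ∑ i, (starRingEnd ℂ) (ψ i) * φ i

/-- `e` is a unitary identification of the code space with a space of logical qubits. -/
def IsUnitaryEquiv (L : Submodule (ZMod 2) (QV P)) (σ : PauliSection L) {d : ℕ}
    (e : ↥(code L σ) ≃ₗ[ℂ] HP (Fin d)) : Prop :=
  ∀ ψ φ : ↥(code L σ),
    innerF (e ψ) (e φ) = innerF (ψ : HP P) (φ : HP P)

/-- The operator acting as `w` on the logical qubit `k` and trivially elsewhere. -/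
def oneQubitOp (d : ℕ) (k : Fin d) (w : Matrix (Fin 2) (Fin 2) ℂ) : MatP (Fin d) :=
  locOp fun j => if j = k then w else 1

/-- The set of rotations in `SO(3)` induced, via the identification `e`, on a fixed
logical qubit `k` by (exactly realised) transversal gates, i.e. by elements of `A(L, σ)`. -/
def logicalSet (L : Submodule (ZMod 2) (QV P)) (σ : PauliSection L) {d : ℕ}
    (e : ↥(code L σ) ≃ₗ[ℂ] HP (Fin d)) (k : Fin d) : Set Rot :=
  {A | ∃ w ∈ Matrix.unitaryGroup (Fin 2) ℂ, adjRot w = A ∧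
        ∃ u : P → Matrix (Fin 2) (Fin 2) ℂ,
          (∀ p, u p ∈ Matrix.unitaryGroup (Fin 2) ℂ) ∧
          ∀ φ : HP (Fin d),
            locOp u *ᵥ ((e.symm φ : HP P)) = ((e.symm (oneQubitOp d k w *ᵥ φ) : HP P))}

/-! ### Reed–Muller codes -/

/-- The qubit set `P = 𝔽₂^m ∖ {0}`. -/
abbrev RMQubits (m : ℕ) := {s : Fin m → ZMod 2 // s ≠ 0}

/-- Polynomial functions on `𝔽₂^m` of degree at most `r` with zero constant term. -/
def RMspan (r m : ℕ) : Submodule (ZMod 2) ((Fin m → ZMod 2) → ZMod 2) :=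
  Submodule.span (ZMod 2)
    {f | ∃ I : Finset (Fin m), I.Nonempty ∧ I.card ≤ r ∧ f = fun s => ∏ i ∈ I, s i}

/-- The shortened Reed–Muller code `R_*(r, m) ⊆ 𝔽₂^P`. -/
def RMstar (r m : ℕ) : Submodule (ZMod 2) (RMQubits m → ZMod 2) :=
  Submodule.map (LinearMap.funLeft (ZMod 2) (ZMod 2) Subtype.val) (RMspan r m)

/-- The `z`-part of a phase-space vector. -/
def zPart {P : Type} : QV P →ₗ[ZMod 2] (P → ZMod 2) where
  toFun v := fun p => (v p).1
  map_add' := by intros; rfl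
  map_smul' := by intros; rfl

/-- The `x`-part of a phase-space vector. -/
def xPart {P : Type} : QV P →ₗ[ZMod 2] (P → ZMod 2) where
  toFun v := fun p => (v p).2
  map_add' := by intros; rfl
  map_smul' := by intros; rfl

/-- The Calderbank–Shor–Steane isotropic subspace built from the shortened Reed–Muller
codes `R_*(m−2, m)` (in the `z`-coordinates) and `R_*(1, m)` (in the `x`-coordinates). -/
def cssL (m : ℕ) : Submodule (ZMod 2) (QV (RMQubits m)) :=
  Submodule.comap zPart (RMstar (m - 2) m) ⊓ Submodule.comap xPart (RMstar 1 m)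

/-- The stabilizer state `|0⟩_S ⊗ |0⟩_T + |0⟩_S ⊗ |1⟩_T + |1⟩_S ⊗ |0⟩_T − |1⟩_S ⊗ |1⟩_T`
(with `T = Sᶜ`), written in the computational basis. -/
def bellLike (S : Set P) (p q : P) : HP P := fun u =>
  if (∀ a ∈ S, u a = u p) ∧ (∀ a ∈ Sᶜ, u a = u q) then
    ((-1 : ℂ)) ^ ((u p : Fin 2).val * (u q : Fin 2).val) else 0


set_option linter.unusedSectionVars false

/-! ### Elementary facts about the one-qubit form and about supports -/

lemma omegaV_eq_zero_iff : ∀ a b : V, b ≠ 0 → (omegaV a b = 0 ↔ a = 0 ∨ a = b) := by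
  unfold omegaV; decide

lemma eq_omegaV_smul_add : ∀ a b c : V, a ≠ 0 → b ≠ 0 → a ≠ b →
    c = omegaV c b • a + omegaV c a • b := by
  unfold omegaV; decide

lemma exists_omegaV_eq_one : ∀ a : V, a ≠ 0 → ∃ b, omegaV a b = 1 := by
  unfold omegaV; decide

lemma V_add_self (a : V) : a + a = 0 := CharTwo.add_self_eq_zero a

lemma V_add_eq_zero {a b : V} : a + b = 0 ↔ a = b := CharTwo.add_eq_zero

/-- The symplectic automorphism of `V` taking a symplectic basis `(a, b)` to `(z, x)`. -/
def sympBasisEquiv (a b : V) (h : omegaV a b = 1) : V ≃ₗ[ZMod 2] V where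
  toFun v := (omegaV v b, omegaV a v)
  map_add' u v := by ext <;> simp [omegaV] <;> ring
  map_smul' c v := by ext <;> simp [omegaV] <;> ring
  invFun w := w.1 • a + w.2 • b
  left_inv := by
    revert a b
    unfold omegaV
    decide
  right_inv := by
    revert a b
    unfold omegaV
    decide

lemma sympBasisEquiv_apply (a b : V) (h : omegaV a b = 1) (v : V) :
    sympBasisEquiv a b h v = (omegaV v b, omegaV a v) := rfl

lemma omegaV_self (a : V) : omegaV a a = 0 := by
  simp only [omegaV, mul_comm a.2]
  exact CharTwo.add_self_eq_zero _

lemma omegaV_sympBasisEquiv (a b : V) (h : omegaV a b = 1) (u v : V) :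
    omegaV (sympBasisEquiv a b h u) (sympBasisEquiv a b h v) = omegaV u v := by
  have key : omegaV (sympBasisEquiv a b h u) (sympBasisEquiv a b h v)
      = omegaV a b * omegaV u v := by
    have h2 : (2 : ZMod 2) = 0 := rfl
    simp only [sympBasisEquiv_apply, omegaV]
    linear_combination (a.1 * b.1 * u.2 * v.2 + a.2 * b.2 * u.1 * v.1) * h2
  rw [key, h, one_mul]

lemma QV_add_self (v : QV P) : v + v = 0 := funext fun p => V_add_self (v p)

lemma mem_supp {v : QV P} {p : P} : p ∈ supp v ↔ v p ≠ 0 := Iff.rfl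

lemma ne_zero_left_of_supp_eq {v : QV P} {p q : P} (h : supp v = {p, q}) : v p ≠ 0 :=
  mem_supp.1 (h ▸ Set.mem_insert p {q})

lemma ne_zero_right_of_supp_eq {v : QV P} {p q : P} (h : supp v = {p, q}) : v q ≠ 0 :=
  mem_supp.1 (h ▸ Set.mem_insert_of_mem p rfl)

lemma eq_zero_of_supp_eq {v : QV P} {p q s : P} (h : supp v = {p, q}) (hp : s ≠ p)
    (hq : s ≠ q) : v s = 0 := by
  by_contra hs
  have : s ∈ supp v := hs
  rw [h] at this
  simp_all

lemma supp_eq_pair {v : QV P} {p q : P} (hp : v p ≠ 0) (hq : v q ≠ 0)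
    (h : ∀ s, s ≠ p → s ≠ q → v s = 0) : supp v = {p, q} := by
  ext s
  simp only [mem_supp, Set.mem_insert_iff, Set.mem_singleton_iff]
  constructor
  · intro hs
    by_contra! hc
    exact hs (h s hc.1 hc.2)
  · rintro (rfl | rfl) <;> assumption

lemma omega_eq_single (u v : QV P) (p : P) (h : ∀ s, s ≠ p → u s = 0 ∨ v s = 0) :
    omega u v = omegaV (u p) (v p) := by
  refine Finset.sum_eq_single p (fun s _ hs => ?_) (by simp)
  rcases h s hs with h | h <;> simp [h, omegaV]

lemma omega_eq_pair (u v : QV P) {p q : P} (hpq : p ≠ q)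
    (h : ∀ s, s ≠ p → s ≠ q → u s = 0 ∨ v s = 0) :
    omega u v = omegaV (u p) (v p) + omegaV (u q) (v q) := by
  refine Finset.sum_eq_add p q hpq (fun s _ hs => ?_) (by simp) (by simp)
  rcases h s hs.1 hs.2 with h | h <;> simp [h, omegaV]

/-! ### Contiguity -/

section Contiguity

variable {L : Submodule (ZMod 2) (QV P)}

/-- Without trivial factors an isotropic subspace has no vectors supported on one qubit. -/
lemma eq_zero_of_supp_subset_singleton (hL : Isotropic L) (htriv : ¬ HasTrivialFactor L)
    {v : QV P} (hv : v ∈ L) {p : P} (h : ∀ s, s ≠ p → v s = 0) : v = 0 := by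
  by_contra hv0
  have hvp : v p ≠ 0 := by
    intro hp
    apply hv0
    funext s
    by_cases hs : s = p
    · rw [hs, hp]; rfl
    · exact h s hs
  refine htriv ⟨p, fun u hu => ?_, v, hv, hv0, fun s hs => ?_⟩
  · have h0 := hL u hu v hv
    rw [omega_eq_single u v p fun s hs => Or.inr (h s hs), omegaV_eq_zero_iff _ _ hvp] at h0
    rcases h0 with h0 | h0
    · have : restrTo {p} u = 0 := by
        funext s
        by_cases hs : s = p
        · simp [restrTo, hs, h0]
        · simp [restrTo, hs]
      rw [this]
      exact L.zero_mem
    · have : restrTo {p} u = v := by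
        funext s
        by_cases hs : s = p
        · simp [restrTo, hs, h0]
        · simp [restrTo, hs, h s hs]
      rwa [this]
  · by_contra hsp
    exact hs (h s hsp)

/-- Vectors of `L` supported on two pairs with a common qubit agree on that qubit. -/
lemma apply_eq_of_supp_pair (hL : Isotropic L) (htriv : ¬ HasTrivialFactor L)
    (hbell : ¬ HasBellFactor L) {p q r : P} (hpq : p ≠ q) {v w : QV P}
    (hv : v ∈ L) (hw : w ∈ L) (hsv : supp v = {p, q}) (hsw : supp w = {p, r}) :
    v p = w p := by
  have hvp := ne_zero_left_of_supp_eq hsv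
  have hwp := ne_zero_left_of_supp_eq hsw
  by_cases hqr : q = r
  · subst hqr
    have hvq := ne_zero_right_of_supp_eq hsv
    have hwq := ne_zero_right_of_supp_eq hsw
    by_contra hne
    have hneq : v q ≠ w q := by
      intro he
      have h0 : v + w = 0 := by
        refine eq_zero_of_supp_subset_singleton hL htriv (L.add_mem hv hw) (p := p) ?_
        intro s hs
        by_cases hsq : s = q
        · subst hsq
          rw [Pi.add_apply, he, V_add_self]
        · rw [Pi.add_apply, eq_zero_of_supp_eq hsv hs hsq, eq_zero_of_supp_eq hsw hs hsq, add_zero]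
      exact hne (V_add_eq_zero.1 (congrFun h0 p))
    refine hbell ⟨p, q, hpq, fun u hu => ?_, v, hv, w, hw, fun h => hne (congrFun h p), hsv, hsw,
      supp_eq_pair (fun h => hne (V_add_eq_zero.1 h)) (fun h => hneq (V_add_eq_zero.1 h))
        fun s hs hs' => ?_⟩
    · have h1 := hL u hu v hv
      have h2 := hL u hu w hw
      rw [omega_eq_pair u v hpq fun s hs hs' => Or.inr (eq_zero_of_supp_eq hsv hs hs'),
        CharTwo.add_eq_zero] at h1
      rw [omega_eq_pair u w hpq fun s hs hs' => Or.inr (eq_zero_of_supp_eq hsw hs hs'),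
        CharTwo.add_eq_zero] at h2
      have : restrTo {p, q} u = omegaV (u p) (w p) • v + omegaV (u p) (v p) • w := by
        funext s
        by_cases hsp : s = p
        · subst hsp
          simpa [restrTo] using eq_omegaV_smul_add _ _ (u s) hvp hwp hne
        by_cases hsq : s = q
        · subst hsq
          rw [h1, h2]
          simpa [restrTo] using eq_omegaV_smul_add _ _ (u s) hvq hwq hneq
        · simp [restrTo, hsp, hsq, eq_zero_of_supp_eq hsv hsp hsq, eq_zero_of_supp_eq hsw hsp hsq]
      rw [this]
      exact L.add_mem (L.smul_mem _ hv) (L.smul_mem _ hw)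
    · rw [Pi.add_apply, eq_zero_of_supp_eq hsv hs hs', eq_zero_of_supp_eq hsw hs hs', add_zero]
  · have h0 := hL v hv w hw
    rw [omega_eq_single v w p fun s hs => ?_, omegaV_eq_zero_iff _ _ hwp] at h0
    · exact h0.resolve_left hvp
    · by_cases hsq : s = q
      · exact Or.inr (eq_zero_of_supp_eq hsw hs (hsq ▸ hqr))
      · exact Or.inl (eq_zero_of_supp_eq hsv hs hsq)

lemma Contig.symm {p q : P} (h : Contig L p q) : Contig L q p := by
  rcases h with h | ⟨v, hv, hs⟩
  · exact Or.inl h.symm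
  · exact Or.inr ⟨v, hv, hs.trans (Set.pair_comm p q)⟩

lemma Contig.trans (hL : Isotropic L) (htriv : ¬ HasTrivialFactor L)
    (hbell : ¬ HasBellFactor L) {p q r : P} (hpq : Contig L p q) (hqr : Contig L q r) :
    Contig L p r := by
  by_cases epr : p = r
  · exact Or.inl epr
  by_cases epq : p = q
  · exact epq ▸ hqr
  by_cases eqr : q = r
  · exact eqr ▸ hpq
  obtain ⟨v, hv, hsv⟩ := hpq.symm.resolve_left (Ne.symm epq)
  obtain ⟨w, hw, hsw⟩ := hqr.resolve_left eqr
  have he := apply_eq_of_supp_pair hL htriv hbell (Ne.symm epq) hv hw hsv hsw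
  refine Or.inr ⟨v + w, L.add_mem hv hw, supp_eq_pair ?_ ?_ fun s hs hs' => ?_⟩
  · rw [Pi.add_apply, eq_zero_of_supp_eq hsw epq epr, add_zero]
    exact ne_zero_right_of_supp_eq hsv
  · rw [Pi.add_apply, eq_zero_of_supp_eq hsv (Ne.symm eqr) (Ne.symm epr), zero_add]
    exact ne_zero_right_of_supp_eq hsw
  · by_cases hsq : s = q
    · rw [hsq, Pi.add_apply, he, V_add_self]
    · rw [Pi.add_apply, eq_zero_of_supp_eq hsv hsq hs, eq_zero_of_supp_eq hsw hsq hs', add_zero]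

lemma contigClass_eq (hL : Isotropic L) (htriv : ¬ HasTrivialFactor L)
    (hbell : ¬ HasBellFactor L) {p q : P} (h : q ∈ contigClass L p) :
    contigClass L q = contigClass L p :=
  Set.ext fun _ => ⟨fun hr => Contig.trans hL htriv hbell h hr,
    fun hr => Contig.trans hL htriv hbell (Contig.symm h) hr⟩

/-- Every vector of `L` supported on a pair of qubits takes prescribed values there. -/
lemma exists_pair_values (hL : Isotropic L) (htriv : ¬ HasTrivialFactor L)
    (hbell : ¬ HasBellFactor L) :
    ∃ a : P → V, (∀ p, a p ≠ 0) ∧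
      ∀ v ∈ L, ∀ p q, p ≠ q → supp v = {p, q} → v p = a p := by
  have (p : P) : ∃ c : V, c ≠ 0 ∧ ∀ v ∈ L, ∀ q, p ≠ q → supp v = {p, q} → v p = c := by
    by_cases h : ∃ w ∈ L, ∃ r, p ≠ r ∧ supp w = {p, r}
    · obtain ⟨w, hw, r, hr, hsw⟩ := h
      exact ⟨w p, ne_zero_left_of_supp_eq hsw, fun v hv q hpq hsv =>
        apply_eq_of_supp_pair hL htriv hbell hpq hv hw hsv hsw⟩
    · exact ⟨(1, 0), by decide, fun v hv q hpq hsv => absurd ⟨v, hv, q, hpq, hsv⟩ h⟩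
  choose a ha0 ha using this
  exact ⟨a, ha0, fun v hv p q hpq hsv => ha p v hv q hpq hsv⟩

/-- Complete `a` to a family of symplectic bases, realising on each contiguity class a vector of
`L` that pairs to `1` with `a` on the whole class, if there is one. -/
lemma exists_symplectic_complement (hL : Isotropic L) (htriv : ¬ HasTrivialFactor L)
    (hbell : ¬ HasBellFactor L) (a : P → V) (ha : ∀ p, a p ≠ 0) :
    ∃ b : P → V, (∀ p, omegaV (a p) (b p) = 1) ∧
      ∀ p, (∃ u ∈ LS L (contigClass L p), ∀ q ∈ contigClass L p, omegaV (a q) (u q) = 1) →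
        (contigClass L p).indicator b ∈ L := by
  have (S : Set P) : ∃ b : P → V, (∀ p ∈ S, omegaV (a p) (b p) = 1) ∧
      ((∃ u ∈ LS L S, ∀ q ∈ S, omegaV (a q) (u q) = 1) → S.indicator b ∈ L) := by
    by_cases h : ∃ u ∈ LS L S, ∀ q ∈ S, omegaV (a q) (u q) = 1
    · obtain ⟨u, hu, h1⟩ := h
      refine ⟨u, h1, fun _ => ?_⟩
      rw [Set.indicator_eq_self.2 fun s hs => ?_]
      · exact hu.1
      · by_contra hsS
        exact hs (hu.2 s hsS)
    · choose b hb using fun p => exists_omegaV_eq_one (a p) (ha p)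
      exact ⟨b, fun p _ => hb p, fun h' => absurd h' h⟩
  choose g hg1 hg2 using this
  refine ⟨fun p => g (contigClass L p) p, fun p => hg1 _ p (Or.inl rfl), fun p h => ?_⟩
  convert hg2 _ h using 1
  refine Set.indicator_congr fun q hq => ?_
  rw [contigClass_eq hL htriv hbell hq]

end Contiguity

/-! ### Local symplectic transformations -/

section Transport

variable {L : Submodule (ZMod 2) (QV P)} {f : P → (V ≃ₗ[ZMod 2] V)}

lemma mem_mapL {v : QV P} : v ∈ mapL L f ↔ ∃ u ∈ L, v = fun p => f p (u p) :=
  ⟨fun ⟨u, hu, h⟩ => ⟨u, hu, h.symm⟩, fun ⟨u, hu, h⟩ => ⟨u, hu, h.symm⟩⟩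

lemma supp_local_apply (u : QV P) : supp (fun p => f p (u p)) = supp u := by
  ext p
  simp [mem_supp]

lemma contigClass_mapL (p : P) : contigClass (mapL L f) p = contigClass L p := by
  ext q
  refine or_congr_right ⟨?_, ?_⟩
  · rintro ⟨v, hv, hs⟩
    obtain ⟨u, hu, rfl⟩ := mem_mapL.1 hv
    exact ⟨u, hu, (supp_local_apply u).symm.trans hs⟩
  · rintro ⟨u, hu, hs⟩
    exact ⟨_, mem_mapL.2 ⟨u, hu, rfl⟩, (supp_local_apply u).trans hs⟩

lemma isotropic_mapL (hL : Isotropic L) (hf : IsLocalSymp f) : Isotropic (mapL L f) := by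
  intro v hv w hw
  obtain ⟨v, hv', rfl⟩ := mem_mapL.1 hv
  obtain ⟨w, hw', rfl⟩ := mem_mapL.1 hw
  simpa only [omega, hf _ _ _] using hL v hv' w hw'

end Transport

/-! ### The normal form on a single set of qubits -/

section NormalForm

variable {M : Submodule (ZMod 2) (QV P)} {S : Set P}

lemma zvec_add_mem_zspan {p q : P} (hp : p ∈ S) (hq : q ∈ S) : zvec q + zvec p ∈ zspan S := by
  by_cases h : q = p
  · subst h
    rw [QV_add_self]
    exact Submodule.zero_mem _
  · exact Submodule.subset_span ⟨q, hq, p, hp, h, rfl⟩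

lemma mem_zspan_of_snd_eq_zero (h1 : ∀ v ∈ M, ∀ p, (∀ s, s ≠ p → v s = 0) → v = 0)
    (hz : zspan S ≤ M) {p : P} (hp : p ∈ S) {u : QV P} (hu : u ∈ LS M S)
    (hx : ∀ s ∈ S, (u s).2 = 0) : u ∈ zspan S := by
  have hsum : u = ∑ q, (u q).1 • (zvec q + zvec p) + (∑ q, (u q).1) • zvec p := by
    simp only [smul_add, Finset.sum_add_distrib, ← Finset.sum_smul]
    rw [add_assoc, QV_add_self, add_zero]
    funext s
    rw [Finset.sum_apply, Finset.sum_eq_single s]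
    · by_cases hs : s ∈ S
      · ext <;> simp [zvec, hx s hs]
      · simp [hu.2 s hs]
    · intro q _ hq
      simp [zvec, Ne.symm hq]
    · simp
  have hmem : ∑ q, (u q).1 • (zvec q + zvec p) ∈ zspan S := by
    refine Submodule.sum_mem _ fun q _ => ?_
    by_cases hq : q ∈ S
    · exact Submodule.smul_mem _ _ (zvec_add_mem_zspan hp hq)
    · simp [hu.2 q hq]
  have hrest : (∑ q, (u q).1) • zvec p ∈ M :=
    (Submodule.add_mem_iff_right M (hz hmem)).1 (hsum ▸ hu.1)
  rw [h1 _ hrest p fun s hs => by simp [zvec, hs], add_zero] at hsum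
  exact hsum ▸ hmem

lemma zspan_le_coordSub : zspan S ≤ coordSub S := by
  refine Submodule.span_le.2 ?_
  rintro _ ⟨a, ha, b, hb, -, rfl⟩ s hs
  have hsa : s ≠ a := fun h => hs (h ▸ ha)
  have hsb : s ≠ b := fun h => hs (h ▸ hb)
  simp [zvec, hsa, hsb]

lemma snd_eq_of_zspan_le (hM : Isotropic M) (hz : zspan S ≤ M) {v : QV P} (hv : v ∈ M)
    {p q : P} (hp : p ∈ S) (hq : q ∈ S) : (v q).2 = (v p).2 := by
  by_cases h : q = p
  · rw [h]
  have h0 := hM v hv _ (hz (zvec_add_mem_zspan hp hq))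
  rw [omega_eq_pair _ _ h fun s hs hs' => Or.inr (by simp [zvec, hs, hs']),
    CharTwo.add_eq_zero] at h0
  simpa [zvec, omegaV, h, Ne.symm h] using h0

lemma LS_eq_zspan_or (hM : Isotropic M) (h1 : ∀ v ∈ M, ∀ p, (∀ s, s ≠ p → v s = 0) → v = 0)
    (hz : zspan S ≤ M) {p : P} (hp : p ∈ S)
    (hx : (∃ u ∈ LS M S, (u p).2 ≠ 0) → xsumOn S ∈ M) :
    LS M S = zspan S ∨ LS M S = zspan S ⊔ Submodule.span (ZMod 2) {xsumOn S} := by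
  have hle : zspan S ≤ LS M S := le_inf hz zspan_le_coordSub
  have hcore (u) (hu : u ∈ LS M S) (hup : (u p).2 = 0) : u ∈ zspan S :=
    mem_zspan_of_snd_eq_zero h1 hz hp hu fun s hs =>
      (snd_eq_of_zspan_le hM hz hu.1 hp hs).trans hup
  by_cases h : ∃ u ∈ LS M S, (u p).2 ≠ 0
  · right
    have hxS : xsumOn S ∈ LS M S := ⟨hx h, fun s hs => by simp [xsumOn, hs]⟩
    refine le_antisymm (fun v hv => ?_) (sup_le hle (by simpa using hxS))
    by_cases hvp : (v p).2 = 0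
    · exact Submodule.mem_sup_left (hcore v hv hvp)
    · have hvx : v + xsumOn S ∈ zspan S := by
        refine hcore _ (Submodule.add_mem _ hv hxS) ?_
        have hone : (v p).2 = 1 := Fin.eq_one_of_ne_zero _ hvp
        simp only [Pi.add_apply, Prod.snd_add, hone, xsumOn, Set.indicator_of_mem hp]
        exact CharTwo.add_self_eq_zero 1
      have hv' : v = (v + xsumOn S) + xsumOn S := by
        rw [add_assoc, QV_add_self, add_zero]
      rw [hv']
      exact Submodule.add_mem_sup hvx (Submodule.mem_span_singleton_self _)
  · left
    refine le_antisymm (fun v hv => hcore v hv ?_) hle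
    by_contra hvp
    exact h ⟨v, hv, hvp⟩

end NormalForm

/-- **Normalisation lemma.** Let `L ⊆ V^P` be an isotropic subspace free of zero,
trivial, and Bell factors. Applying a suitable local symplectic automorphism of `V^P`
one can achieve that for each contiguity class `S` either
`L_S = ⟨z_p + z_q : p ≠ q⟩` or `L_S = ⟨z_p + z_q : p ≠ q⟩ + ⟨Σ_{s∈S} x_s⟩`. -/
theorem normalisation {P : Type} [Fintype P] [DecidableEq P]
    (L : Submodule (ZMod 2) (QV P)) (hL : Isotropic L)
    (hzero : ¬ HasZeroFactor L) (htriv : ¬ HasTrivialFactor L)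
    (hbell : ¬ HasBellFactor L) :
    ∃ f : P → (V ≃ₗ[ZMod 2] V), IsLocalSymp f ∧ NormalForm (mapL L f) := by
  obtain ⟨a, ha0, ha⟩ := exists_pair_values hL htriv hbell
  obtain ⟨b, hb, hbL⟩ := exists_symplectic_complement hL htriv hbell a ha0
  let f : P → (V ≃ₗ[ZMod 2] V) := fun p => sympBasisEquiv (a p) (b p) (hb p)
  have hf : IsLocalSymp f := fun p => omegaV_sympBasisEquiv (a p) (b p) (hb p)
  have hfa (p : P) : f p (a p) = (1, 0) := by
    simp [f, sympBasisEquiv_apply, hb, omegaV_self]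
  have hfb (p : P) : f p (b p) = (0, 1) := by
    simp [f, sympBasisEquiv_apply, hb, omegaV_self]
  have hM : Isotropic (mapL L f) := isotropic_mapL hL hf
  refine ⟨f, hf, fun p => ?_⟩
  rw [contigClass_mapL]
  have hz : zspan (contigClass L p) ≤ mapL L f := by
    refine Submodule.span_le.2 ?_
    rintro _ ⟨q, hq, r, hr, hqr, rfl⟩
    obtain ⟨v, hv, hsv⟩ :=
      (Contig.trans hL htriv hbell (Contig.symm hq) hr).resolve_left hqr
    refine mem_mapL.2 ⟨v, hv, funext fun s => ?_⟩
    by_cases hsq : s = q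
    · subst hsq
      rw [ha v hv s r hqr hsv, hfa]
      simp [zvec, hqr]
    by_cases hsr : s = r
    · subst hsr
      rw [ha v hv s q (Ne.symm hqr) (hsv.trans (Set.pair_comm _ _)), hfa]
      simp [zvec, hsq]
    · simp [zvec, hsq, hsr, eq_zero_of_supp_eq hsv hsq hsr]
  refine LS_eq_zspan_or hM (fun v hv q hq => ?_) hz (Or.inl rfl) ?_
  · obtain ⟨u, hu, rfl⟩ := mem_mapL.1 hv
    have hu0 : u = 0 := eq_zero_of_supp_subset_singleton hL htriv hu (p := q)
      fun s hs => by simpa using hq s hs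
    funext s
    simp [hu0]
  · rintro ⟨v, ⟨hv, hvS⟩, hvp⟩
    have hv1 (q) (hq : q ∈ contigClass L p) : (v q).2 = 1 := by
      rw [snd_eq_of_zspan_le hM hz hv (Or.inl rfl) hq]
      exact Fin.eq_one_of_ne_zero _ hvp
    obtain ⟨u, hu, rfl⟩ := mem_mapL.1 hv
    refine mem_mapL.2 ⟨_, hbL p ⟨u, ⟨hu, fun s hs => by simpa using hvS s hs⟩, hv1⟩,
      funext fun s => ?_⟩
    by_cases hs : s ∈ contigClass L p
    · simp [xsumOn, hs, hfb]
    · simp [xsumOn, hs]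

end Stab
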